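/- Let e = {a,b} be an edge of G that is neither a bridge nor incident to the sink. Then the lacking polynomial satisfies the deletion–contraction recurrence L_G(x) = x·L_{G∖e}(x) + L_{G.e}(x). -/

import Mathlib

open Finset Polynomial

open scoped Classical

namespace SSM

variable {V : Type*} [Fintype V] [DecidableEq V]

/-- The degree of a vertex: sum of edge multiplicities to all other vertices.
    Vertices are `Option V`, with `none` playing the role of the sink `s`. -/
def deg (m : Option V → Option V → ℕ) (u : Option V) : ℕ := ∑ w : Option V, m u w

/-- `m` is a symmetric, loop-free edge-multiplicity function whose underlying
    graph is connected. -/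
def IsGraph (m : Option V → Option V → ℕ) : Prop :=
  (∀ u w, m u w = m w u) ∧ (∀ u, m u u = 0) ∧
    (SimpleGraph.fromRel fun u w : Option V => m u w ≠ 0).Connected

/-- An orientation of the multigraph: `o u w` copies of the edge `{u,w}` are
    oriented from `u` to `w`, and `o u w + o w u = m u w`. -/
def IsOrientation (m o : Option V → Option V → ℕ) : Prop :=
  ∀ u w, o u w + o w u = m u w

/-- In-degree of a vertex in an orientation. -/
def inDeg (o : Option V → Option V → ℕ) (w : Option V) : ℕ := ∑ u : Option V, o u w

/-- A configuration is stable if every non-sink vertex carries at most its degree. -/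
def Stable (m : Option V → Option V → ℕ) (η : V → ℕ) : Prop :=
  ∀ v : V, η v ≤ deg m (some v)

/-- `η` is compatible with the orientation `o`: for each non-sink vertex `v`,
    `in_O(v) ≥ 1 + l_η(v)`, stated additively as `deg v + 1 ≤ in_O(v) + η v`. -/
def Compatible (m o : Option V → Option V → ℕ) (η : V → ℕ) : Prop :=
  ∀ v : V, deg m (some v) + 1 ≤ inDeg o (some v) + η v

/-- The set `Sto(G)`: stable configurations compatible with at least one orientation. -/
def Sto (m : Option V → Option V → ℕ) (η : V → ℕ) : Prop :=
  Stable m η ∧ ∃ o, IsOrientation m o ∧ Compatible m o η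

/-- Total lacking number `ℓ(η) = ∑_v (deg v − η v)`. -/
def totalLacking (m : Option V → Option V → ℕ) (η : V → ℕ) : ℕ :=
  ∑ v : V, (deg m (some v) - η v)

/-- The lacking polynomial `L_G(x) = ∑_{η ∈ Sto(G)} x^{ℓ(η)}`. -/
noncomputable def lackingPoly (m : Option V → Option V → ℕ) : Polynomial ℤ :=
  ∑ η ∈ (Fintype.piFinset fun v : V => Finset.range (deg m (some v) + 1)).filter
      (fun η => Sto m η),
    (X : Polynomial ℤ) ^ totalLacking m η

/-- The maximal stable configuration `η^max`. -/
def etaMax (m : Option V → Option V → ℕ) : V → ℕ := fun v => deg m (some v)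

/-- A grain addition at some non-sink vertex. -/
def AddGrain (η η' : V → ℕ) : Prop := ∃ v : V, η' = Function.update η v (η v + 1)

/-- A legal partial toppling: some vertex `x` with `η x > deg x` sends `α u ≤ m x u`
    grains to each vertex `u` (grains sent to the sink are lost). -/
def PartialTopple (m : Option V → Option V → ℕ) (η η' : V → ℕ) : Prop :=
  ∃ x : V, deg m (some x) < η x ∧ ∃ α : Option V → ℕ, (∀ u, α u ≤ m (some x) u) ∧
    ∀ v : V, η' v = if v = x then η x - ∑ u : Option V, α u else η v + α (some v)

/-- Reachability by a finite sequence of grain additions and legal partial topplings. -/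
def Reaches (m : Option V → Option V → ℕ) : (V → ℕ) → (V → ℕ) → Prop :=
  Relation.ReflTransGen fun η η' => AddGrain η η' ∨ PartialTopple m η η'

/-- A legal full toppling (Abelian sandpile model): an unstable vertex `x` sends
    `m x u` grains to each vertex `u`. -/
def FullTopple (m : Option V → Option V → ℕ) (η η' : V → ℕ) : Prop :=
  ∃ x : V, deg m (some x) < η x ∧
    ∀ v : V, η' v = if v = x then η x - deg m (some x) else η v + m (some x) (some v)

/-- `η` passes the burning algorithm: the non-sink vertices can be enumerated
    `v_1, …, v_n` with `η(v_i) > ∑_{j > i} m(v_i, v_j)`. -/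
def Burns (m : Option V → Option V → ℕ) (η : V → ℕ) : Prop :=
  ∃ e : Fin (Fintype.card V) ≃ V, ∀ i : Fin (Fintype.card V),
    ∑ j ∈ Finset.univ.filter (fun j : Fin (Fintype.card V) => i < j),
      m (some (e i)) (some (e j)) < η (e i)

/-- An orientation is acyclic if the digraph with an arc `u → w` whenever
    `o u w ≥ 1` has no directed cycle. -/
def IsAcyclic (o : Option V → Option V → ℕ) : Prop :=
  ∀ u : Option V, ¬ Relation.TransGen (fun x y : Option V => 1 ≤ o x y) u u

/-- Deletion of one copy of the edge `{a,b}`. -/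
def deleteM (m : Option V → Option V → ℕ) (a b : V) (u w : Option V) : ℕ :=
  if (u = some a ∧ w = some b) ∨ (u = some b ∧ w = some a) then m u w - 1 else m u w

/-- Contraction of the edge `{a,b}`: merge `b` into `a` (the merged vertex `a.b` is
    represented by `a` in the subtype `{v // v ≠ b}`), delete all `k = m a b` edges
    between `a` and `b`, and add `k − 1` new edges between `a.b` and the sink. -/
def contractM (m : Option V → Option V → ℕ) (a b : V) :
    Option {v : V // v ≠ b} → Option {v : V // v ≠ b} → ℕ
  | none, none => 0
  | none, some w =>
      if w.1 = a then m none (some a) + m none (some b) + (m (some a) (some b) - 1)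
      else m none (some w.1)
  | some u, none =>
      if u.1 = a then m none (some a) + m none (some b) + (m (some a) (some b) - 1)
      else m (some u.1) none
  | some u, some w =>
      if u.1 = a then
        (if w.1 = a then 0 else m (some a) (some w.1) + m (some b) (some w.1))
      else if w.1 = a then m (some u.1) (some a) + m (some u.1) (some b)
      else m (some u.1) (some w.1)

/-- `Sto_A(G)`: configurations in `Sto(G)` having a compatible orientation with
    `o(a,b) ≥ 1` and `l_η(b) > 0`. -/
def StoA (m : Option V → Option V → ℕ) (a b : V) (η : V → ℕ) : Prop :=
  Stable m η ∧ ∃ o, IsOrientation m o ∧ Compatible m o η ∧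
    1 ≤ o (some a) (some b) ∧ η b < deg m (some b)

/-- `Sto_B(G) = Sto(G) ∖ Sto_A(G)`. -/
def StoB (m : Option V → Option V → ℕ) (a b : V) (η : V → ℕ) : Prop :=
  Sto m η ∧ ¬ StoA m a b η

/-- On `Sto_A(G)`, `f(η) = η − 1_a`, a configuration on `G∖e`. -/
def fA (a : V) (η : V → ℕ) : V → ℕ := Function.update η a (η a - 1)

/-- On `Sto_B(G)`, `f(η)` is the configuration on `G.e` agreeing with `η` away from
    `a, b` and with `f(η)(a.b) = deg_{G.e}(a.b) − l_η(a) − l_η(b)`. -/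
def fB (m : Option V → Option V → ℕ) (a b : V) (hab : a ≠ b) (η : V → ℕ)
    (v : {v : V // v ≠ b}) : ℕ :=
  if v.1 = a then
    deg (contractM m a b) (some ⟨a, hab⟩) -
      ((deg m (some a) - η a) + (deg m (some b) - η b))
  else η v.1

/-- `T = (V' ∪ {r}, E')` is a tree branch of `G`: a sub-multigraph (with edge
    multiplicities `mT` on non-sink vertices) which is a tree on `V' ∪ {r}`,
    such that every `v ∈ V'` has all of its `G`-edges inside `T`, and which is
    attached to the rest of `G` only at `r ∈ V ∖ V'`. -/
structure IsTreeBranch (m : Option V → Option V → ℕ) (V' : Finset V) (r : V)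
    (mT : V → V → ℕ) : Prop where
  not_mem : r ∉ V'
  symm : ∀ u v, mT u v = mT v u
  loopless : ∀ v, mT v v = 0
  le : ∀ u v, mT u v ≤ m (some u) (some v)
  support : ∀ u v, mT u v ≠ 0 → (u ∈ V' ∨ u = r) ∧ (v ∈ V' ∨ v = r)
  deg_eq : ∀ v ∈ V', ∑ u : V, mT v u = deg m (some v)
  conn : ∀ v ∈ V', (SimpleGraph.fromRel fun x y : V => mT x y ≠ 0).Reachable r v
  card_edges : ∑ u : V, ∑ v : V, mT u v = 2 * V'.card


/-- Lacking vectors realised by an orientation. -/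
def PP (m : Option V → Option V → ℕ) (l : V → ℕ) : Prop :=
  ∃ o, IsOrientation m o ∧ ∀ v : V, l v + 1 ≤ inDeg o (some v)

theorem PP.le_deg {m : Option V → Option V → ℕ} {l : V → ℕ} (h : PP m l) (v : V) :
    l v ≤ deg m (some v) := by
  obtain ⟨o, ho, h⟩ := h
  have : inDeg o (some v) ≤ deg m (some v) :=
    Finset.sum_le_sum fun u _ => by have := ho (some v) u; omega
  have := h v
  omega

noncomputable def AA (m : Option V → Option V → ℕ) : Finset (V → ℕ) :=
  (Fintype.piFinset fun v : V => Finset.range (deg m (some v) + 1)).filter (fun l => PP m l)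

theorem mem_AA {m : Option V → Option V → ℕ} {l : V → ℕ} : l ∈ AA m ↔ PP m l := by
  simp only [AA, Finset.mem_filter, Fintype.mem_piFinset, Finset.mem_range]
  exact ⟨fun h => h.2, fun h => ⟨fun v => Nat.lt_succ_of_le (h.le_deg v), h⟩⟩

theorem lackingPoly_eq (m : Option V → Option V → ℕ) :
    lackingPoly m = ∑ l ∈ AA m, (X : Polynomial ℤ) ^ (∑ v, l v) := by
  unfold lackingPoly
  refine Finset.sum_bij' (fun η _ v => deg m (some v) - η v) (fun l _ v => deg m (some v) - l v)
    ?_ ?_ ?_ ?_ ?_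
  · intro η hη
    rw [Finset.mem_filter] at hη
    obtain ⟨-, hs, o, ho, hc⟩ := hη
    rw [mem_AA]
    refine ⟨o, ho, fun v => ?_⟩
    have := hs v; have := hc v
    show deg m (some v) - η v + 1 ≤ _
    omega
  · intro l hl
    rw [mem_AA] at hl
    simp only [Finset.mem_filter, Fintype.mem_piFinset, Finset.mem_range]
    refine ⟨fun v => by omega, fun v => Nat.sub_le _ _, ?_⟩
    have hd := hl.le_deg
    obtain ⟨o, ho, h⟩ := hl
    refine ⟨o, ho, fun v => ?_⟩
    have := hd v; have := h v
    show _ ≤ inDeg o (some v) + (deg m (some v) - l v)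
    omega
  · intro η hη
    rw [Finset.mem_filter] at hη
    funext v
    have := hη.2.1 v
    show deg m (some v) - (deg m (some v) - η v) = η v
    omega
  · intro l hl
    rw [mem_AA] at hl
    funext v
    have := hl.le_deg v
    show deg m (some v) - (deg m (some v) - l v) = l v
    omega
  · intro η _
    rfl

/-- twice the number of edges touching S -/
def FF (m : Option V → Option V → ℕ) (S : Finset V) : ℕ :=
  ∑ u : Option V, ∑ w : Option V,
    if (∃ v ∈ S, u = some v) ∨ (∃ v ∈ S, w = some v) then m u w else 0

theorem FF_eq {m o : Option V → Option V → ℕ} (ho : IsOrientation m o) (S : Finset V) :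
    FF m S = 2 * ∑ u : Option V, ∑ w : Option V,
      if (∃ v ∈ S, u = some v) ∨ (∃ v ∈ S, w = some v) then o u w else 0 := by
  rw [two_mul]
  nth_rewrite 2 [Finset.sum_comm]
  rw [← Finset.sum_add_distrib]
  refine Finset.sum_congr rfl fun u _ => ?_
  rw [← Finset.sum_add_distrib]
  refine Finset.sum_congr rfl fun w _ => ?_
  rw [← ho u w]
  by_cases h1 : ∃ v ∈ S, u = some v <;> by_cases h2 : ∃ v ∈ S, w = some v <;> simp [h1, h2]

theorem exists_orientation {m : Option V → Option V → ℕ} (hs : ∀ u w, m u w = m w u)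
    (hl : ∀ u, m u u = 0) : ∃ o, IsOrientation m o := by
  let e := Fintype.equivFin (Option V)
  refine ⟨fun u w => if e u < e w then m u w else 0, fun u w => ?_⟩
  rcases lt_trichotomy (e u) (e w) with h | h | h
  · simp [h, h.not_gt]
  · have := e.injective h
    subst this
    simp [hl]
  · simp [h, h.not_gt, hs u w]

theorem PP.crit {m : Option V → Option V → ℕ} {l : V → ℕ} (h : PP m l) (S : Finset V) :
    2 * ∑ v ∈ S, (l v + 1) ≤ FF m S := by
  obtain ⟨o, ho, h⟩ := h
  rw [FF_eq ho]
  refine Nat.mul_le_mul_left 2 ?_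
  calc ∑ v ∈ S, (l v + 1) ≤ ∑ v ∈ S, inDeg o (some v) := Finset.sum_le_sum fun v _ => h v
    _ = ∑ w ∈ S.map Function.Embedding.some, ∑ u : Option V, o u w := by
        rw [Finset.sum_map]; rfl
    _ = ∑ w : Option V, ∑ u : Option V, if (∃ v ∈ S, w = some v) then o u w else 0 := by
        rw [← Finset.sum_subset (Finset.subset_univ (S.map Function.Embedding.some))]
        · refine Finset.sum_congr rfl fun w hw => ?_
          obtain ⟨v, hv, rfl⟩ := Finset.mem_map.1 hw
          simp [hv]
        · intro w _ hw
          refine Finset.sum_eq_zero fun u _ => if_neg ?_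
          rintro ⟨v, hv, rfl⟩
          exact hw (Finset.mem_map.2 ⟨v, hv, rfl⟩)
    _ ≤ _ := by
        rw [Finset.sum_comm]
        refine Finset.sum_le_sum fun u _ => Finset.sum_le_sum fun w _ => ?_
        by_cases h2 : ∃ v ∈ S, w = some v <;> simp [h2]

theorem PP.of_crit {m : Option V → Option V → ℕ} (hs : ∀ u w, m u w = m w u)
    (hl : ∀ u, m u u = 0) {l : V → ℕ}
    (h : ∀ S : Finset V, 2 * ∑ v ∈ S, (l v + 1) ≤ FF m S) : PP m l := by
  obtain ⟨o, ho⟩ := exists_orientation hs hl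
  let inc : (Σ v : V, Fin (l v + 1)) → Finset (Σ p : Option V × Option V, Fin (o p.1 p.2)) := fun x =>
    Finset.univ.filter fun e => e.1.1 = some x.1 ∨ e.1.2 = some x.1
  have hall : ∀ T : Finset (Σ v : V, Fin (l v + 1)), T.card ≤ (T.biUnion inc).card := by
    intro T
    let S := T.image Sigma.fst
    have h1 : T.card ≤ ∑ v ∈ S, (l v + 1) := by
      have : T ⊆ S.sigma (fun _ => Finset.univ) := by
        intro x hx
        simp only [Finset.mem_sigma, Finset.mem_univ, and_true]
        exact Finset.mem_image_of_mem _ hx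
      refine (Finset.card_le_card this).trans ?_
      simp
    have h2 := h S
    rw [FF_eq ho] at h2
    refine (h1.trans (Nat.le_of_mul_le_mul_left h2 two_pos)).trans (le_of_eq ?_)
    have : T.biUnion inc = (Finset.univ.filter fun p : Option V × Option V =>
        (∃ v ∈ S, p.1 = some v) ∨ (∃ v ∈ S, p.2 = some v)).sigma (fun _ => Finset.univ) := by
      ext e
      simp only [inc, S, Finset.mem_biUnion, Finset.mem_filter, Finset.mem_univ, true_and,
        Finset.mem_sigma, and_true, Finset.mem_image]
      constructor
      · rintro ⟨x, hx, h | h⟩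
        · exact Or.inl ⟨x.1, ⟨x, hx, rfl⟩, h⟩
        · exact Or.inr ⟨x.1, ⟨x, hx, rfl⟩, h⟩
      · rintro (⟨v, ⟨x, hx, rfl⟩, h⟩ | ⟨v, ⟨x, hx, rfl⟩, h⟩)
        · exact ⟨x, hx, Or.inl h⟩
        · exact ⟨x, hx, Or.inr h⟩
    rw [this, Finset.card_sigma, Finset.sum_filter, Fintype.sum_prod_type]
    simp
  obtain ⟨f, hf, hfm⟩ := (Finset.all_card_le_biUnion_card_iff_exists_injective inc).1 hall
  let head : (Σ p : Option V × Option V, Fin (o p.1 p.2)) → Option V := fun e => if hx : ∃ x, f x = e then some hx.choose.1 else e.1.2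
  have hhead : ∀ x, head (f x) = some x.1 := by
    intro x
    have hx : ∃ y, f y = f x := ⟨x, rfl⟩
    have : hx.choose = x := hf hx.choose_spec
    simp only [head, dif_pos hx, this]
  have hhm : ∀ e, head e = e.1.1 ∨ head e = e.1.2 := by
    intro e
    by_cases hx : ∃ x, f x = e
    · obtain ⟨x, rfl⟩ := hx
      rw [hhead]
      have := hfm x
      simp only [inc, Finset.mem_filter, Finset.mem_univ, true_and] at this
      rcases this with h | h
      · exact Or.inl h.symm
      · exact Or.inr h.symm
    · right; simp only [head, dif_neg hx]
  have hne : ∀ e : (Σ p : Option V × Option V, Fin (o p.1 p.2)), e.1.1 ≠ e.1.2 := by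
    rintro ⟨⟨u, w⟩, i⟩ (h : u = w)
    subst h
    have := ho u u
    rw [hl] at this
    have h2 := i.2
    simp only at h2
    omega
  have hcard : ∀ p : Option V × Option V,
      (Finset.univ.filter fun e : (Σ p : Option V × Option V, Fin (o p.1 p.2)) => e.1 = p).card = o p.1 p.2 := by
    intro p
    have : (Finset.univ.filter fun e : (Σ p : Option V × Option V, Fin (o p.1 p.2)) => e.1 = p)
        = ({p} : Finset _).sigma (fun _ => Finset.univ) := by
      ext e; simp
    rw [this, Finset.card_sigma]
    simp
  refine ⟨fun u w => (Finset.univ.filter fun e : (Σ p : Option V × Option V, Fin (o p.1 p.2)) =>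
    (e.1 = (u, w) ∨ e.1 = (w, u)) ∧ head e = w ∧ u ≠ w).card, ?_, ?_⟩
  · intro u w
    by_cases huw : u = w
    · subst huw; simp [hl]
    · rw [← ho u w, ← hcard (u, w), ← hcard (w, u), ← Finset.card_union_of_disjoint,
        ← Finset.card_union_of_disjoint]
      · congr 1
        ext e
        simp only [Finset.mem_union, Finset.mem_filter, Finset.mem_univ, true_and]
        constructor
        · tauto
        · intro h
          have h3 := hhm e
          have h4 : u ≠ w := huw
          have h5 : w ≠ u := Ne.symm huw
          rcases h with h | h <;> rw [h] at h3 <;> simp only at h3 <;> tauto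
      · rw [Finset.disjoint_left]
        intro e h1 h2
        simp only [Finset.mem_filter, Finset.mem_univ, true_and] at h1 h2
        rw [h1] at h2
        exact huw (Prod.ext_iff.1 h2).1
      · rw [Finset.disjoint_left]
        intro e h1 h2
        simp only [Finset.mem_filter, Finset.mem_univ, true_and] at h1 h2
        exact huw (h2.2.1.symm.trans h1.2.1)
  · intro v
    unfold inDeg
    rw [← Finset.card_biUnion]
    · have : (Finset.univ : Finset (Fin (l v + 1))).card = l v + 1 := by simp
      rw [← this]
      refine Finset.card_le_card_of_injOn (fun i => f ⟨v, i⟩) ?_ ?_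
      · intro i _
        simp only [Finset.coe_biUnion, Set.mem_iUnion, Finset.coe_filter, Finset.mem_univ, true_and,
          Finset.coe_univ, Set.mem_univ, Set.mem_ofPred_eq, exists_prop]
        have h1 := hhead ⟨v, i⟩
        have h2 := hhm (f ⟨v, i⟩)
        have h3 := hne (f ⟨v, i⟩)
        rw [h1] at h2
        rcases h2 with h2 | h2
        · exact ⟨(f ⟨v, i⟩).1.2, Or.inr (Prod.ext h2.symm rfl), h1, by
            rw [h2]; exact h3.symm⟩
        · exact ⟨(f ⟨v, i⟩).1.1, Or.inl (Prod.ext rfl h2.symm), h1, by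
            rw [h2]; exact h3⟩
      · intro i _ j _ hij
        have := hf hij
        simpa using this
    · intro u _ u' _ huu'
      rw [Function.onFun, Finset.disjoint_left]
      intro e h1 h2
      simp only [Finset.mem_filter, Finset.mem_univ, true_and] at h1 h2
      obtain ⟨h1, -, h3⟩ := h1
      obtain ⟨h2, -, h4⟩ := h2
      rcases h1 with h1 | h1 <;> rw [h1] at h2 <;> simp only [Prod.mk.injEq] at h2 <;> tauto

theorem deleteM_symm {m : Option V → Option V → ℕ} (hs : ∀ u w, m u w = m w u) (a b : V)
    (u w : Option V) : deleteM m a b u w = deleteM m a b w u := by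
  unfold deleteM
  rw [hs u w]
  congr 1
  apply propext
  tauto

theorem deleteM_loop {m : Option V → Option V → ℕ} (hl : ∀ u, m u u = 0) (a b : V)
    (u : Option V) : deleteM m a b u u = 0 := by
  unfold deleteM
  rw [hl]
  simp

theorem FF_delete {m : Option V → Option V → ℕ} (hs : ∀ u w, m u w = m w u) {a b : V}
    (hab : a ≠ b) (hk : 1 ≤ m (some a) (some b)) (S : Finset V) :
    FF m S = FF (deleteM m a b) S + if a ∈ S ∨ b ∈ S then 2 else 0 := by
  have key : ∀ u w : Option V, m u w = deleteM m a b u w +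
      ((if u = some a then if w = some b then 1 else 0 else 0) +
       (if u = some b then if w = some a then 1 else 0 else 0)) := by
    intro u w
    unfold deleteM
    have hab' : some a ≠ some b := fun h => hab (Option.some.inj h)
    have hk' : 1 ≤ m (some b) (some a) := by rw [hs]; exact hk
    by_cases h1 : u = some a
    · subst h1
      by_cases h2 : w = some b
      · subst h2; simp [hab, hab.symm]; omega
      · simp [h2, hab]
    · by_cases h3 : u = some b
      · subst h3
        by_cases h2 : w = some a
        · subst h2; simp [hab, hab.symm]; omega
        · simp [h2, hab.symm]
      · simp [h1, h3]
  unfold FF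
  have : ∀ u w : Option V, (if (∃ v ∈ S, u = some v) ∨ (∃ v ∈ S, w = some v) then m u w else 0) =
    (if (∃ v ∈ S, u = some v) ∨ (∃ v ∈ S, w = some v) then deleteM m a b u w else 0) +
      ((if u = some a then if w = some b then if a ∈ S ∨ b ∈ S then 1 else 0 else 0 else 0) +
       (if u = some b then if w = some a then if a ∈ S ∨ b ∈ S then 1 else 0 else 0 else 0)) := by
    intro u w
    rw [key u w]
    by_cases h : (∃ v ∈ S, u = some v) ∨ (∃ v ∈ S, w = some v)
    · simp only [if_pos h]
      congr 2 <;> split_ifs <;> simp_all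
    · simp only [if_neg h]
      split_ifs <;> simp_all
  simp only [this, Finset.sum_add_distrib]
  congr 1
  simp [Finset.sum_ite_eq', Finset.sum_ite_irrel]
  split_ifs <;> rfl

theorem sum_update_succ (l : V → ℕ) (c : V) (S : Finset V) :
    ∑ v ∈ S, (Function.update l c (l c + 1) v + 1) =
      ∑ v ∈ S, (l v + 1) + if c ∈ S then 1 else 0 := by
  have : ∀ v, Function.update l c (l c + 1) v + 1 = (l v + 1) + if v = c then 1 else 0 := by
    intro v
    by_cases h : v = c
    · subst h; simp
    · simp [h]
  simp only [this]
  rw [Finset.sum_add_distrib]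
  simp

theorem PP_delete_iff {m : Option V → Option V → ℕ} (hs : ∀ u w, m u w = m w u)
    (hl : ∀ u, m u u = 0) {a b : V}
    (hab : a ≠ b) (hk : 1 ≤ m (some a) (some b)) (l : V → ℕ) :
    PP (deleteM m a b) l ↔
      PP m (Function.update l a (l a + 1)) ∧ PP m (Function.update l b (l b + 1)) := by
  constructor
  · intro h
    constructor <;>
    · refine PP.of_crit hs hl fun S => ?_
      have := h.crit S
      rw [sum_update_succ, FF_delete hs hab hk]
      split_ifs <;> first | omega | tauto
  · rintro ⟨h1, h2⟩
    refine PP.of_crit (deleteM_symm hs a b) (deleteM_loop hl a b) fun S => ?_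
    have h1 := h1.crit S
    have h2 := h2.crit S
    rw [sum_update_succ, FF_delete hs hab hk] at h1 h2
    split_ifs at h1 h2 <;> first | omega | tauto

theorem sum_split (l : V → ℕ) {a b : V} (hab : a ≠ b) (S : Finset V) :
    ∑ v ∈ S, (l v + 1) = ∑ v ∈ S, (if v = a then 0 else if v = b then 0 else l v + 1) +
      ((if a ∈ S then l a + 1 else 0) + (if b ∈ S then l b + 1 else 0)) := by
  have : ∀ v, l v + 1 = (if v = a then 0 else if v = b then 0 else l v + 1) +
      ((if v = a then l a + 1 else 0) + (if v = b then l b + 1 else 0)) := by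
    intro v
    by_cases h : v = a
    · subst h; simp [hab]
    · by_cases h' : v = b
      · subst h'; simp [h]
      · simp [h, h']
  conv_lhs => rw [Finset.sum_congr rfl fun v _ => this v]
  simp only [Finset.sum_add_distrib, Finset.sum_ite_eq']

theorem PP_convex {m : Option V → Option V → ℕ} (hs : ∀ u w, m u w = m w u)
    (hl : ∀ u, m u u = 0) {a b : V} (hab : a ≠ b) {l₁ l₂ l : V → ℕ}
    (h1 : PP m l₁) (h2 : PP m l₂) (e1 : ∀ v, v ≠ a → v ≠ b → l v = l₁ v)
    (e2 : ∀ v, v ≠ a → v ≠ b → l v = l₂ v) (s1 : l a + l b = l₁ a + l₁ b)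
    (s2 : l a + l b = l₂ a + l₂ b) (i1 : l₁ a ≤ l a) (i2 : l a ≤ l₂ a) : PP m l := by
  refine PP.of_crit hs hl fun S => ?_
  have h1 := h1.crit S
  have h2 := h2.crit S
  rw [sum_split _ hab] at h1 h2 ⊢
  have E1 : ∑ v ∈ S, (if v = a then 0 else if v = b then 0 else l v + 1) =
      ∑ v ∈ S, (if v = a then 0 else if v = b then 0 else l₁ v + 1) := by
    refine Finset.sum_congr rfl fun v _ => ?_
    split_ifs with p q
    · rfl
    · rfl
    · rw [e1 v p q]
  have E2 : ∑ v ∈ S, (if v = a then 0 else if v = b then 0 else l v + 1) =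
      ∑ v ∈ S, (if v = a then 0 else if v = b then 0 else l₂ v + 1) := by
    refine Finset.sum_congr rfl fun v _ => ?_
    split_ifs with p q
    · rfl
    · rfl
    · rw [e2 v p q]
  rw [← E1] at h1
  rw [← E2] at h2
  split_ifs at h1 h2 ⊢ <;> omega

theorem sum_V (g : Option V → ℕ) {a b : V} (hab : a ≠ b) :
    ∑ u : Option V, g u = g none + g (some a) + g (some b) +
      ∑ u : {v : V // v ≠ b}, if u.1 = a then 0 else g (some u.1) := by
  rw [Fintype.sum_option]
  have h1 : ∑ u : V, g (some u) = g (some b) + ∑ u : {v : V // v ≠ b}, g (some u.1) := by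
    rw [← Fintype.sum_subtype_add_sum_subtype (fun v : V => v ≠ b) (fun u => g (some u)), add_comm]
    congr 1
    rw [← Finset.sum_subtype ({b} : Finset V) (by simp) (fun u => g (some u))]
    simp
  have h2 : ∑ u : {v : V // v ≠ b}, g (some u.1) = g (some a) +
      ∑ u : {v : V // v ≠ b}, if u.1 = a then 0 else g (some u.1) := by
    have : ∀ u : {v : V // v ≠ b}, g (some u.1) =
        (if u = ⟨a, hab⟩ then g (some a) else 0) + if u.1 = a then 0 else g (some u.1) := by
      intro u
      by_cases h : u.1 = a
      · have : u = ⟨a, hab⟩ := Subtype.ext h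
        subst this; simp
      · have : u ≠ ⟨a, hab⟩ := fun h' => h (by rw [h'])
        simp [h, this]
    conv_lhs => rw [Finset.sum_congr rfl fun v _ => this v]
    rw [Finset.sum_add_distrib]
    simp
  rw [h1, h2]
  omega

theorem sum_W {b : V} (g : Option {v : V // v ≠ b} → ℕ) {a : V} (hab : a ≠ b) :
    ∑ u, g u = g none + g (some ⟨a, hab⟩) +
      ∑ u : {v : V // v ≠ b}, if u.1 = a then 0 else g (some u) := by
  rw [Fintype.sum_option]
  have h2 : ∑ u : {v : V // v ≠ b}, g (some u) = g (some ⟨a, hab⟩) +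
      ∑ u : {v : V // v ≠ b}, if u.1 = a then 0 else g (some u) := by
    have : ∀ u : {v : V // v ≠ b}, g (some u) =
        (if u = ⟨a, hab⟩ then g (some ⟨a, hab⟩) else 0) + if u.1 = a then 0 else g (some u) := by
      intro u
      by_cases h : u.1 = a
      · have : u = ⟨a, hab⟩ := Subtype.ext h
        subst this; simp
      · have : u ≠ ⟨a, hab⟩ := fun h' => h (by rw [h'])
        simp [h, this]
    conv_lhs => rw [Finset.sum_congr rfl fun v _ => this v]
    rw [Finset.sum_add_distrib]
    simp
  rw [h2]
  omega

def merge (a b : V) (l : V → ℕ) (v : {v : V // v ≠ b}) : ℕ :=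
  if v.1 = a then l a + l b else l v.1

def contractO (k : ℕ) (o : Option V → Option V → ℕ) (a b : V) :
    Option {v : V // v ≠ b} → Option {v : V // v ≠ b} → ℕ
  | none, none => 0
  | none, some w =>
      if w.1 = a then o none (some a) + o none (some b) + (k - 1)
      else o none (some w.1)
  | some u, none =>
      if u.1 = a then o (some a) none + o (some b) none
      else o (some u.1) none
  | some u, some w =>
      if u.1 = a then
        (if w.1 = a then 0 else o (some a) (some w.1) + o (some b) (some w.1))
      else if w.1 = a then o (some u.1) (some a) + o (some u.1) (some b)
      else o (some u.1) (some w.1)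

theorem PP_merge {m : Option V → Option V → ℕ} (hs : ∀ u w, m u w = m w u)
    (hl : ∀ u, m u u = 0) {a b : V} (hab : a ≠ b) (hk : 1 ≤ m (some a) (some b))
    {l : V → ℕ} (h : PP m l) : PP (contractM m a b) (merge a b l) := by
  obtain ⟨o, ho, h⟩ := h
  refine ⟨contractO (m (some a) (some b)) o a b, ?_, ?_⟩
  · rintro (_ | u) (_ | w)
    · rfl
    · simp only [contractO, contractM]
      have h1 := ho none (some a)
      have h2 := ho none (some b)
      have h3 := ho none (some w.1)
      split_ifs <;> omega
    · simp only [contractO, contractM]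
      have h1 := ho none (some a)
      have h2 := ho none (some b)
      have h3 := ho (some u.1) none
      split_ifs <;> omega
    · simp only [contractO, contractM]
      have h1 := ho (some u.1) (some a)
      have h2 := ho (some u.1) (some b)
      have h3 := ho (some a) (some w.1)
      have h4 := ho (some b) (some w.1)
      have h5 := ho (some u.1) (some w.1)
      split_ifs <;> omega
  · intro w
    have oa : o (some a) (some a) = 0 := by have := ho (some a) (some a); rw [hl] at this; omega
    have ob : o (some b) (some b) = 0 := by have := ho (some b) (some b); rw [hl] at this; omega
    have hw := h w.1
    have ha := h a
    have hb := h b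
    unfold inDeg at hw ha hb ⊢
    rw [sum_V _ hab] at hw ha hb
    rw [sum_W _ hab]
    by_cases hwa : w.1 = a
    · simp only [merge, contractO, hwa, if_true]
      have : ∑ u : {v : V // v ≠ b}, (if u.1 = a then 0 else
            if u.1 = a then 0 else o (some u.1) (some a) + o (some u.1) (some b)) =
          ∑ u : {v : V // v ≠ b}, (if u.1 = a then 0 else o (some u.1) (some a)) +
          ∑ u : {v : V // v ≠ b}, (if u.1 = a then 0 else o (some u.1) (some b)) := by
        rw [← Finset.sum_add_distrib]
        refine Finset.sum_congr rfl fun u _ => ?_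
        split_ifs <;> rfl
      rw [this]
      have := ho (some a) (some b)
      omega
    · simp only [merge, contractO, hwa, if_true, if_false]
      have : ∑ u : {v : V // v ≠ b}, (if u.1 = a then 0 else
            if u.1 = a then o (some a) (some w.1) + o (some b) (some w.1)
              else o (some u.1) (some w.1)) =
          ∑ u : {v : V // v ≠ b}, (if u.1 = a then 0 else o (some u.1) (some w.1)) := by
        refine Finset.sum_congr rfl fun u _ => ?_
        split_ifs <;> rfl
      rw [this]
      omega

/-- projection of vertices; the value at `b` is irrelevant -/
def proj (b : V) : Option V → Option {v : V // v ≠ b}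
  | none => none
  | some v => if h : v ≠ b then some ⟨v, h⟩ else none

def liftO (m : Option V → Option V → ℕ) (a b : V) (hab : a ≠ b)
    (o : Option {v : V // v ≠ b} → Option {v : V // v ≠ b} → ℕ) (p q : ℕ)
    (u w : Option V) : ℕ :=
  let c : Option {v : V // v ≠ b} := some ⟨a, hab⟩
  let x : Option V → ℕ := fun u => min (o (proj b u) c) (m u (some a))
  let y : Option V → ℕ := fun u => min (o (proj b u) c - x u) (m u (some b))
  if u = some a then
    if w = some a then 0 else if w = some b then p else m w (some a) - x w
  else if u = some b then
    if w = some a then q else if w = some b then 0 else m w (some b) - y w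
  else if w = some a then x u else if w = some b then y u else o (proj b u) (proj b w)

theorem liftO_isOrientation {m : Option V → Option V → ℕ} (hs : ∀ u w, m u w = m w u)
    (hl : ∀ u, m u u = 0) {a b : V} (hab : a ≠ b) 
    {o : Option {v : V // v ≠ b} → Option {v : V // v ≠ b} → ℕ}
    (ho : IsOrientation (contractM m a b) o) {p q : ℕ} (hpq : p + q = m (some a) (some b)) :
    IsOrientation m (liftO m a b hab o p q) := by
  intro u w
  have hba : some b ≠ some a := fun h => hab (Option.some.inj h).symm
  simp only [liftO]
  by_cases ua : u = some a
  · by_cases wa : w = some a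
    · simp [ua, wa, hl]
    · by_cases wb : w = some b
      · simp only [ua, wb, if_true, if_neg hba]; omega
      · simp only [ua, wa, wb, if_true, if_false]
        rw [hs (some a) w]; omega
  · by_cases ub : u = some b
    · by_cases wa : w = some a
      · simp only [ub, wa, if_true, if_neg hba]; rw [hs]; omega
      · by_cases wb : w = some b
        · simp [ub, wb, hl, hab.symm]
        · simp only [ub, wa, wb, if_true, if_false, if_neg hba]
          rw [hs (some b) w]; omega
    · by_cases wa : w = some a
      · simp only [ua, ub, wa, if_true, if_false]; omega
      · by_cases wb : w = some b
        · simp only [ua, ub, wb, if_neg hba, if_true, if_false]; omega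
        · simp only [ua, ub, wa, wb, if_false]
          rw [ho]
          rcases u with _ | u <;> rcases w with _ | w
          · simp [contractM, proj, hl]
          · have : w ≠ b := fun h => wb (by rw [h])
            have : w ≠ a := fun h => wa (by rw [h])
            simp [contractM, proj, *]
          · have : u ≠ b := fun h => ub (by rw [h])
            have : u ≠ a := fun h => ua (by rw [h])
            simp [contractM, proj, *]
          · have : w ≠ b := fun h => wb (by rw [h])
            have : w ≠ a := fun h => wa (by rw [h])
            have : u ≠ b := fun h => ub (by rw [h])
            have : u ≠ a := fun h => ua (by rw [h])
            simp [contractM, proj, *]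

theorem PP_lift {m : Option V → Option V → ℕ} (hs : ∀ u w, m u w = m w u)
    (hl : ∀ u, m u u = 0) {a b : V} (hab : a ≠ b) (hk : 1 ≤ m (some a) (some b))
    {l' : {v : V // v ≠ b} → ℕ} (h : PP (contractM m a b) l') :
    ∃ l, PP m l ∧ merge a b l = l' := by
  obtain ⟨o, ho, h⟩ := h
  have hba : some b ≠ some a := fun h => hab (Option.some.inj h).symm
  let c : Option {v : V // v ≠ b} := some ⟨a, hab⟩
  let x : Option V → ℕ := fun u => min (o (proj b u) c) (m u (some a))
  let y : Option V → ℕ := fun u => min (o (proj b u) c - x u) (m u (some b))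
  let A := x none + ∑ u : {v : V // v ≠ b}, if u.1 = a then 0 else x (some u.1)
  let B := y none + ∑ u : {v : V // v ≠ b}, if u.1 = a then 0 else y (some u.1)
  have hinA : ∀ p q, inDeg (liftO m a b hab o p q) (some a) = A + q := by
    intro p q
    unfold inDeg
    rw [sum_V _ hab]
    have : ∑ u : {v : V // v ≠ b}, (if u.1 = a then 0 else
        liftO m a b hab o p q (some u.1) (some a)) =
        ∑ u : {v : V // v ≠ b}, if u.1 = a then 0 else x (some u.1) := by
      refine Finset.sum_congr rfl fun u _ => ?_
      by_cases hu : u.1 = a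
      · simp [hu]
      · simp [hu, liftO, u.2, x, c]
    rw [this]
    have h1 : liftO m a b hab o p q none (some a) = x none := by simp [liftO, x, c]
    have h2 : liftO m a b hab o p q (some a) (some a) = 0 := by simp [liftO]
    have h3 : liftO m a b hab o p q (some b) (some a) = q := by simp [liftO, hab.symm]
    rw [h1, h2, h3]
    simp only [A]
    omega
  have hinB : ∀ p q, inDeg (liftO m a b hab o p q) (some b) = B + p := by
    intro p q
    unfold inDeg
    rw [sum_V _ hab]
    have : ∑ u : {v : V // v ≠ b}, (if u.1 = a then 0 else
        liftO m a b hab o p q (some u.1) (some b)) =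
        ∑ u : {v : V // v ≠ b}, if u.1 = a then 0 else y (some u.1) := by
      refine Finset.sum_congr rfl fun u _ => ?_
      by_cases hu : u.1 = a
      · simp [hu]
      · simp [hu, liftO, u.2, x, y, c, hab.symm]
    rw [this]
    have h1 : liftO m a b hab o p q none (some b) = y none := by
      simp [liftO, x, y, c, hab.symm]
    have h2 : liftO m a b hab o p q (some a) (some b) = p := by simp [liftO, hab.symm]
    have h3 : liftO m a b hab o p q (some b) (some b) = 0 := by simp [liftO, hab.symm]
    rw [h1, h2, h3]
    simp only [B]
    omega
  have hinO : ∀ p q, ∀ w : {v : V // v ≠ b}, w.1 ≠ a →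
      inDeg (liftO m a b hab o p q) (some w.1) = inDeg o (some w) := by
    intro p q w hw
    unfold inDeg
    rw [sum_V _ hab, sum_W _ hab]
    have : ∑ u : {v : V // v ≠ b}, (if u.1 = a then 0 else
        liftO m a b hab o p q (some u.1) (some w.1)) =
        ∑ u : {v : V // v ≠ b}, if u.1 = a then 0 else o (some u) (some w) := by
      refine Finset.sum_congr rfl fun u _ => ?_
      by_cases hu : u.1 = a
      · simp [hu]
      · simp [hu, liftO, u.2, w.2, hw, proj]
    rw [this]
    have h1 : liftO m a b hab o p q none (some w.1) = o none (some w) := by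
      simp [liftO, hw, w.2, proj]
    have h2 : liftO m a b hab o p q (some a) (some w.1) = m (some w.1) (some a) - x (some w.1) := by
      simp [liftO, hw, w.2, x, c]
    have h3 : liftO m a b hab o p q (some b) (some w.1) = m (some w.1) (some b) - y (some w.1) := by
      simp [liftO, hw, w.2, x, y, c, hab.symm]
    rw [h1, h2, h3]
    have h4 := ho (some w) (some ⟨a, hab⟩)
    simp only [contractM, hw, if_true, if_false] at h4
    have h5 : proj b (some w.1) = some w := by simp [proj, w.2]
    simp only [x, y, h5, c]
    omega
  have hinc : inDeg o c + 1 ≤ A + B + m (some a) (some b) := by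
    unfold inDeg
    rw [sum_W _ hab]
    have h0 : o c c = 0 := by
      have := ho c c
      simp only [contractM, c, if_true] at this
      simp only [c]; omega
    have : ∑ u : {v : V // v ≠ b}, (if u.1 = a then 0 else o (some u) c) =
        (∑ u : {v : V // v ≠ b}, if u.1 = a then 0 else x (some u.1)) +
        (∑ u : {v : V // v ≠ b}, if u.1 = a then 0 else y (some u.1)) := by
      rw [← Finset.sum_add_distrib]
      refine Finset.sum_congr rfl fun u _ => ?_
      by_cases hu : u.1 = a
      · simp [hu]
      · simp only [hu, if_false]
        have h4 := ho (some u) (some ⟨a, hab⟩)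
        simp only [contractM, hu, if_true, if_false] at h4
        have h5 : proj b (some u.1) = some u := by simp [proj, u.2]
        simp only [x, y, h5, c]
        omega
    rw [this]
    have h4 := ho none (some ⟨a, hab⟩)
    simp only [contractM, if_true] at h4
    have h5 : proj b (none : Option V) = none := rfl
    have h6 : o none c + 1 ≤ x none + y none + m (some a) (some b) := by
      simp only [x, y, h5, c]
      rw [hs none (some a), hs none (some b)] at *
      omega
    have h7 : o (some ⟨a, hab⟩) c = 0 := h0
    rw [h7]
    simp only [A, B]
    omega
  have hc := h ⟨a, hab⟩
  have hinc' : inDeg o (some ⟨a, hab⟩) + 1 ≤ A + B + m (some a) (some b) := hinc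
  have hex : ∃ p q i j, p + q = m (some a) (some b) ∧ i + 1 ≤ A + q ∧ j + 1 ≤ B + p ∧
      i + j = l' ⟨a, hab⟩ := by
    obtain ⟨p, q, hpq, h1, h2⟩ : ∃ p q, p + q = m (some a) (some b) ∧ 1 ≤ A + q ∧ 1 ≤ B + p := by
      by_cases hA : 1 ≤ A
      · exact ⟨m (some a) (some b), 0, by omega, by omega, by omega⟩
      · by_cases hB : 1 ≤ B
        · exact ⟨0, m (some a) (some b), by omega, by omega, by omega⟩
        · exact ⟨m (some a) (some b) - 1, 1, by omega, by omega, by omega⟩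
    refine ⟨p, q, min (A + q - 1) (l' ⟨a, hab⟩), l' ⟨a, hab⟩ - min (A + q - 1) (l' ⟨a, hab⟩),
      hpq, ?_, ?_, ?_⟩ <;> omega
  obtain ⟨p, q, i, j, hpq, hi, hj, hij⟩ := hex
  refine ⟨fun v => if hv : v = b then j else if v = a then i else l' ⟨v, hv⟩,
    ⟨liftO m a b hab o p q, liftO_isOrientation hs hl hab ho hpq, fun v => ?_⟩, ?_⟩
  · by_cases hv : v = b
    · subst hv; rw [hinB]; simpa using hj
    · by_cases hva : v = a
      · subst hva; rw [hinA]; simpa [hv] using hi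
      · rw [hinO p q ⟨v, hv⟩ hva]
        simpa [hv, hva] using h ⟨v, hv⟩
  · funext v
    unfold merge
    by_cases hva : v.1 = a
    · have : v = ⟨a, hab⟩ := Subtype.ext hva
      subst this
      simp [hab, hij]
    · simp [hva, v.2]

theorem sum_merge (l : V → ℕ) {a b : V} (hab : a ≠ b) :
    ∑ v, merge a b l v = ∑ v, l v := by
  have h1 := sum_V (fun u => Option.elim u 0 l) hab
  have h2 := sum_W (b := b) (fun u => Option.elim u 0 (merge a b l)) hab
  rw [Fintype.sum_option] at h1 h2
  simp only [Option.elim] at h1 h2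
  have : ∑ u : {v : V // v ≠ b}, (if u.1 = a then 0 else merge a b l u) =
      ∑ u : {v : V // v ≠ b}, if u.1 = a then 0 else l u.1 := by
    refine Finset.sum_congr rfl fun u _ => ?_
    by_cases hu : u.1 = a <;> simp [hu, merge]
  rw [this] at h2
  have : merge a b l ⟨a, hab⟩ = l a + l b := by simp [merge]
  omega

/-- moving one unit from `a` to `b` stays admissible -/
def Q (m : Option V → Option V → ℕ) (a b : V) (l : V → ℕ) : Prop :=
  ∃ l₀, l = Function.update l₀ a (l₀ a + 1) ∧ PP m (Function.update l₀ b (l₀ b + 1))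

theorem merge_eq {a b : V} (hab : a ≠ b) {l₁ l₂ : V → ℕ} (h : merge a b l₁ = merge a b l₂) :
    l₁ a + l₁ b = l₂ a + l₂ b ∧ ∀ v, v ≠ a → v ≠ b → l₁ v = l₂ v := by
  constructor
  · simpa [merge] using congrFun h ⟨a, hab⟩
  · intro v ha hb
    simpa [merge, ha] using congrFun h ⟨v, hb⟩

theorem Q_of_lt {m : Option V → Option V → ℕ} (hs : ∀ u w, m u w = m w u)
    (hl : ∀ u, m u u = 0) {a b : V} (hab : a ≠ b) {l₁ l₂ : V → ℕ} (h1 : PP m l₁) (h2 : PP m l₂)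
    (h : merge a b l₁ = merge a b l₂) (hlt : l₁ a < l₂ a) : Q m a b l₂ := by
  obtain ⟨hsum, he⟩ := merge_eq hab h
  refine ⟨Function.update l₂ a (l₂ a - 1), ?_, ?_⟩
  · funext v
    by_cases hv : v = a
    · subst hv; simp; omega
    · simp [hv]
  · refine PP_convex hs hl hab h1 h2 ?_ ?_ ?_ ?_ ?_ ?_
    · intro v ha hb; simp [ha, hb, he v ha hb]
    · intro v ha hb; simp [ha, hb]
    all_goals simp [hab, hab.symm]
    all_goals omega

theorem exists_notQ {m : Option V → Option V → ℕ} {a b : V} (hab : a ≠ b)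
    {l : V → ℕ} (h : PP m l) : ∃ l₁, PP m l₁ ∧ ¬ Q m a b l₁ ∧ merge a b l₁ = merge a b l := by
  have hex : ∃ n, ∃ l₁, PP m l₁ ∧ merge a b l₁ = merge a b l ∧ l₁ a = n := ⟨l a, l, h, rfl, rfl⟩
  obtain ⟨l₁, h1, h2, h3⟩ := Nat.find_spec hex
  refine ⟨l₁, h1, ?_, h2⟩
  rintro ⟨l₀, rfl, h4⟩
  simp only [Function.update_self] at h3
  refine Nat.find_min hex (m := l₀ a) (by omega) ⟨_, h4, ?_, by simp [hab]⟩
  rw [← h2]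
  funext v
  by_cases hv : v.1 = a
  · simp [merge, hv, hab, hab.symm]; omega
  · simp [merge, hv, v.2]

theorem deletion_contraction_aux {m : Option V → Option V → ℕ} (hs : ∀ u w, m u w = m w u)
    (hl : ∀ u, m u u = 0) {a b : V} (hab : a ≠ b) (hk : 1 ≤ m (some a) (some b)) :
    lackingPoly m =
      Polynomial.X * lackingPoly (deleteM m a b) + lackingPoly (contractM m a b) := by
  rw [lackingPoly_eq, lackingPoly_eq, lackingPoly_eq,
    ← Finset.sum_filter_add_sum_filter_not (AA m) (Q m a b)]
  congr 1
  · rw [Finset.mul_sum]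
    symm
    refine Finset.sum_bij (fun l _ => Function.update l a (l a + 1)) ?_ ?_ ?_ ?_
    · intro l h
      rw [mem_AA, PP_delete_iff hs hl hab hk] at h
      rw [Finset.mem_filter, mem_AA]
      exact ⟨h.1, l, rfl, h.2⟩
    · intro l₁ _ l₂ _ h
      funext v
      have := congrFun h v
      by_cases hv : v = a
      · subst hv; simpa using this
      · simpa [hv] using this
    · intro l h
      rw [Finset.mem_filter, mem_AA] at h
      obtain ⟨h1, l₀, rfl, h2⟩ := h
      exact ⟨l₀, by rw [mem_AA, PP_delete_iff hs hl hab hk]; exact ⟨h1, h2⟩, rfl⟩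
    · intro l _
      rw [← pow_succ']
      congr 1
      have := sum_update_succ l a Finset.univ
      simp only [Finset.sum_add_distrib, Finset.mem_univ, if_true] at this
      omega
  · refine Finset.sum_bij (fun l _ => merge a b l) ?_ ?_ ?_ ?_
    · intro l h
      rw [Finset.mem_filter, mem_AA] at h
      rw [mem_AA]
      exact PP_merge hs hl hab hk h.1
    · intro l₁ h1 l₂ h2 h
      rw [Finset.mem_filter, mem_AA] at h1 h2
      rcases lt_trichotomy (l₁ a) (l₂ a) with hlt | heq | hlt
      · exact absurd (Q_of_lt hs hl hab h1.1 h2.1 h hlt) h2.2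
      · obtain ⟨hsum, he⟩ := merge_eq hab h
        funext v
        by_cases ha : v = a
        · subst ha; exact heq
        · by_cases hb : v = b
          · subst hb; omega
          · exact he v ha hb
      · exact absurd (Q_of_lt hs hl hab h2.1 h1.1 h.symm hlt) h1.2
    · intro l' h
      rw [mem_AA] at h
      obtain ⟨l, h1, rfl⟩ := PP_lift hs hl hab hk h
      obtain ⟨l₁, h2, h3, h4⟩ := exists_notQ hab h1
      exact ⟨l₁, by rw [Finset.mem_filter, mem_AA]; exact ⟨h2, h3⟩, h4⟩
    · intro l _
      rw [sum_merge l hab]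

/-- Deletion–contraction recurrence for the lacking polynomial:
if `e = {a,b}` is neither a bridge nor incident to the sink, then
`L_G(x) = x·L_{G∖e}(x) + L_{G.e}(x)`. -/
theorem lackingPoly_deletion_contraction (m : Option V → Option V → ℕ)
    (hG : IsGraph m) (a b : V) (hab : a ≠ b) (hk : 1 ≤ m (some a) (some b))
    (hnotbridge : (SimpleGraph.fromRel fun u w : Option V =>
      deleteM m a b u w ≠ 0).Connected) :
    lackingPoly m =
      Polynomial.X * lackingPoly (deleteM m a b) + lackingPoly (contractM m a b) := by
  exact deletion_contraction_aux hG.1 hG.2.1 hab hk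

end SSM
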